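/- arXiv:1910.00432 — 4 statements merged into one kernel-verified Lean document; each statement's English description precedes it below -/
import Mathlib

section
/- Let q be an odd positive integer, m ≥ 1, and let T be a real number. On a probability space let X₀, …, X_{m−1} be integer-valued random variables that all have the same distribution, and suppose that for every sign vector y ∈ {−1, +1}^m the random vector (y₀·X₀, …, y_{m−1}·X_{m−1}) has the same joint distribution as (X₀, …, X_{m−1}). For each l let α_l be the integer-valued random variable such that X_l − q·α_l ∈ [−(q−1)/2, (q−1)/2]. Fix a sign vector y ∈ {−1, +1}^m and let E_y = {ω : y_l·(X_l − q·α_l) ≥ 0 for all l} ∩ {T ≤ Σ_{l=0}^{m−1} |X_l − q·α_l| ≤ 2T}. Then P(E_y) ≤ m · P( |X₀| > (q−1)/2 ) + P( T ≤ Σ_{l=0}^{m−1} X_l ≤ 2T ). -/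
open MeasureTheory ProbabilityTheory
open scoped ENNReal

/-- The balanced quotient modulo `q` of an integer in the balanced residue range is zero. -/
theorem balancedQuotient_eq_zero {q x a : ℤ} (hq : 0 < q)
    (ha : |x - q * a| ≤ (q - 1) / 2) (hx : |x| ≤ (q - 1) / 2) : a = 0 := by
  have hlt : |q * a| < q := by
    rw [abs_le] at ha hx
    rw [abs_lt]
    omega
  rw [abs_mul, abs_of_pos hq] at hlt
  have : |a| < 1 := by nlinarith
  exact Int.abs_lt_one_iff.mp this

/-- A sign that makes an integer nonnegative multiplies it to its absolute value. -/
theorem abs_eq_sign_mul {s x : ℤ} (hs : s = 1 ∨ s = -1) (h : 0 ≤ s * x) : |x| = s * x := by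
  rcases hs with rfl | rfl
  · simpa using h
  · simpa using h

/-- Abstract form of Theorem 4 of the paper: for identically distributed integer random
variables `X l` whose joint distribution is invariant under coordinatewise sign flips,
with `α l` the balanced quotient of `X l` modulo the odd integer `q`, the event
`E_y = {∀ l, y l * (X l - q * α l) ≥ 0} ∩ {T ≤ ∑ l |X l - q * α l| ≤ 2T}` indexed by a
sign vector `y` satisfies
`P (E_y) ≤ m * P (|X 0| > (q-1)/2) + P (T ≤ ∑ l X l ≤ 2T)`. -/
theorem sign_pattern_event_prob_le
    {Ω : Type*} [MeasureSpace Ω] [IsProbabilityMeasure (ℙ : Measure Ω)]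
    (q : ℤ) (hq : 0 < q) (hodd : Odd q)
    (m : ℕ) (hm : 1 ≤ m) (T : ℝ)
    (X : Fin m → Ω → ℤ) (hXmeas : ∀ l, Measurable (X l))
    (hident : ∀ l, IdentDistrib (X l) (X ⟨0, hm⟩) ℙ ℙ)
    (hsymm : ∀ y : Fin m → ℤ, (∀ l, y l = 1 ∨ y l = -1) →
      IdentDistrib (fun ω l => y l * X l ω) (fun ω l => X l ω)
        (μ := ℙ) (ν := ℙ))
    (α : Fin m → Ω → ℤ) (hαmeas : ∀ l, Measurable (α l))
    (hα : ∀ l ω, |X l ω - q * α l ω| ≤ (q - 1) / 2)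
    (y : Fin m → ℤ) (hy : ∀ l, y l = 1 ∨ y l = -1) :
    ℙ ({ω | ∀ l, 0 ≤ y l * (X l ω - q * α l ω)} ∩
        {ω | T ≤ ((∑ l, |X l ω - q * α l ω| : ℤ) : ℝ) ∧
              ((∑ l, |X l ω - q * α l ω| : ℤ) : ℝ) ≤ 2 * T})
      ≤ (m : ℝ≥0∞) * ℙ {ω | (q - 1) / 2 < |X ⟨0, hm⟩ ω|}
        + ℙ {ω | T ≤ ((∑ l, X l ω : ℤ) : ℝ) ∧ ((∑ l, X l ω : ℤ) : ℝ) ≤ 2 * T} := by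
  set A : Fin m → Set Ω := fun l => {ω | (q - 1) / 2 < |X l ω|}
  set S : Set (Fin m → ℤ) :=
    {x | T ≤ ((∑ l, x l : ℤ) : ℝ) ∧ ((∑ l, x l : ℤ) : ℝ) ≤ 2 * T}
  have hA : ∀ l, ℙ (A l) = ℙ {ω | (q - 1) / 2 < |X ⟨0, hm⟩ ω|} := fun l =>
    (hident l).measure_mem_eq (s := {x : ℤ | (q - 1) / 2 < |x|}) .of_discrete
  have hS : ℙ {ω | (fun l => y l * X l ω) ∈ S} = ℙ {ω | (fun l => X l ω) ∈ S} :=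
    (hsymm y hy).measure_mem_eq (s := S) S.to_countable.measurableSet
  calc
    _ ≤ ℙ ((⋃ l, A l) ∪ {ω | (fun l => y l * X l ω) ∈ S}) := by
      refine measure_mono ?_
      rintro ω ⟨hsign, hsum⟩
      by_cases hω : ω ∈ ⋃ l, A l
      · exact Or.inl hω
      · right
        have hsmall : ∀ l, |X l ω| ≤ (q - 1) / 2 := by
          simpa [A] using hω
        have habs : ∀ l, |X l ω - q * α l ω| = y l * X l ω := fun l => by
          have h := abs_eq_sign_mul (hy l) (hsign l)
          rwa [balancedQuotient_eq_zero hq (hα l ω) (hsmall l), mul_zero, sub_zero] at h ⊢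
        simp only [Set.mem_ofPred_eq, habs] at hsum
        exact hsum
    _ ≤ ℙ (⋃ l, A l) + ℙ {ω | (fun l => y l * X l ω) ∈ S} := measure_union_le _ _
    _ ≤ (∑ l, ℙ (A l)) + ℙ {ω | (fun l => X l ω) ∈ S} := by
      rw [hS]
      gcongr
      exact measure_iUnion_fintype_le _ _
    _ = _ := by simp [hA, S]
end

section
/- Let n ≥ 1 and let e, s : {0, 1, …, n−1} → ℤ. Let E(X) = Σ_{j=0}^{n−1} e_j X^j and S(X) = Σ_{j=0}^{n−1} s_j X^j be the corresponding polynomials in ℤ[X]/(X^n + 1). Then, for every i ∈ {0, …, n−1}, the coefficient of X^i in the product E·S in ℤ[X]/(X^n + 1) equals Σ_{j=0}^{n−1} sign(i − j) · e_j · s_{(i−j) mod n}, where sign(x) = 1 if x ≥ 0 and sign(x) = −1 otherwise, and (i−j) mod n denotes the representative in {0, …, n−1}. -/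
open Polynomial

/-- The cyclic shift product `(e ⊙ s) i = ∑ j, sign (i - j) * e j * s ((i - j) mod n)`,
where `sign x = 1` if `x ≥ 0` and `sign x = -1` otherwise. -/
noncomputable def cyclicShiftProduct (n : ℕ) (e s : ℕ → ℤ) (i : ℕ) : ℤ :=
  ∑ j ∈ Finset.range n,
    (if (j : ℤ) ≤ (i : ℤ) then (1 : ℤ) else -1) * e j * s (((i : ℤ) - (j : ℤ)) % (n : ℤ)).toNat

/-- Multiplying by `X ^ j` modulo `X ^ n + 1` rotates coefficients by `j`,
negating those that wrap around. -/
theorem X_pow_add_one_dvd_X_pow_mul_sub_rotate (n j : ℕ) (hj : j < n) (s : ℕ → ℤ) :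
    (X ^ n + 1 : ℤ[X]) ∣
      X ^ j * (∑ k ∈ Finset.range n, C (s k) * X ^ k)
        - ∑ i ∈ Finset.range n, C ((if (j : ℤ) ≤ (i : ℤ) then (1 : ℤ) else -1) *
            s (((i : ℤ) - (j : ℤ)) % (n : ℤ)).toNat) * X ^ i := by
  obtain ⟨m, rfl⟩ := Nat.exists_eq_add_of_le hj.le
  have not_wrapped : ∀ k ∈ Finset.range m,
      C ((if (j : ℤ) ≤ ((j + k : ℕ) : ℤ) then (1 : ℤ) else -1) *
        s ((((j + k : ℕ) : ℤ) - (j : ℤ)) % ((j + m : ℕ) : ℤ)).toNat) * X ^ (j + k)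
      = X ^ j * (C (s k) * X ^ k) := by
    intro k hk
    rw [Finset.mem_range] at hk
    have h : ((((j + k : ℕ) : ℤ) - (j : ℤ)) % ((j + m : ℕ) : ℤ)).toNat = k := by
      rw [show (((j + k : ℕ) : ℤ) - (j : ℤ)) = (k : ℤ) by push_cast; ring,
        Int.emod_eq_of_lt (by omega) (by omega), Int.toNat_natCast]
    rw [h, if_pos (by omega)]
    ring_nf
  have wrapped : ∀ k ∈ Finset.range j,
      C ((if (j : ℤ) ≤ (k : ℤ) then (1 : ℤ) else -1) *
        s (((k : ℤ) - (j : ℤ)) % ((j + m : ℕ) : ℤ)).toNat) * X ^ k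
      = -(C (s (m + k)) * X ^ k) := by
    intro k hk
    rw [Finset.mem_range] at hk
    have h : (((k : ℤ) - (j : ℤ)) % ((j + m : ℕ) : ℤ)).toNat = m + k := by
      rw [← Int.add_emod_right, Int.emod_eq_of_lt (by omega) (by omega)]
      omega
    rw [h, if_neg (by omega), neg_one_mul, C_neg, neg_mul]
  have split : ∑ k ∈ Finset.range (j + m), C (s k) * X ^ k
      = ∑ k ∈ Finset.range m, C (s k) * X ^ k
        + ∑ k ∈ Finset.range j, C (s (m + k)) * X ^ (m + k) := by
    rw [add_comm j m, Finset.sum_range_add]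
  rw [split, Finset.sum_range_add _ j m, Finset.sum_congr rfl wrapped,
    Finset.sum_congr rfl not_wrapped, ← Finset.mul_sum, Finset.sum_neg_distrib]
  refine ⟨∑ k ∈ Finset.range j, C (s (m + k)) * X ^ k, ?_⟩
  have shift : ∑ k ∈ Finset.range j, C (s (m + k)) * X ^ (m + k)
      = X ^ m * ∑ k ∈ Finset.range j, C (s (m + k)) * X ^ k := by
    rw [Finset.mul_sum]
    exact Finset.sum_congr rfl fun k _ => by ring
  rw [shift]
  ring

/-- The cyclic shift product computes the coefficients of the negacyclic polynomial
product in `ℤ[X]/(X^n + 1)`: with `E = ∑ j < n, e j * X^j` and `S = ∑ j < n, s j * X^j`,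
the product `E * S` is congruent modulo `X^n + 1` to the polynomial of degree `< n`
whose `i`-th coefficient is `(e ⊙ s) i`. -/
theorem negacyclic_product_coeff (n : ℕ) (hn : 1 ≤ n) (e s : ℕ → ℤ) :
    (X ^ n + 1 : ℤ[X]) ∣
      ((∑ j ∈ Finset.range n, C (e j) * X ^ j) * (∑ j ∈ Finset.range n, C (s j) * X ^ j)
        - ∑ i ∈ Finset.range n, C (cyclicShiftProduct n e s i) * X ^ i) := by
  have expand : ∑ i ∈ Finset.range n, C (cyclicShiftProduct n e s i) * X ^ i
      = ∑ j ∈ Finset.range n, C (e j) * ∑ i ∈ Finset.range n,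
          C ((if (j : ℤ) ≤ (i : ℤ) then (1 : ℤ) else -1) *
            s (((i : ℤ) - (j : ℤ)) % (n : ℤ)).toNat) * X ^ i := by
    simp only [cyclicShiftProduct, map_sum, Finset.sum_mul, Finset.mul_sum]
    rw [Finset.sum_comm]
    refine Finset.sum_congr rfl fun j _ => Finset.sum_congr rfl fun i _ => ?_
    simp only [C_mul]
    ring
  rw [expand, Finset.sum_mul, ← Finset.sum_sub_distrib]
  refine Finset.dvd_sum fun j hj => ?_
  rw [mul_assoc, ← mul_sub]
  exact (X_pow_add_one_dvd_X_pow_mul_sub_rotate n j (Finset.mem_range.mp hj) s).mul_left _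
end

section
/- Let n, k, q, r be positive integers and let e, s', e', s : {0, …, n−1} → ℤ be vectors all of whose entries have absolute value at most k. For vectors in ℤ^n define (e ⊙ s)_i = Σ_{j=0}^{n−1} sign(i−j)·e_j·s_{(i−j) mod n}, where sign(x) = 1 if x ≥ 0 and sign(x) = −1 otherwise. Let c'' and c be integers with |c''| ≤ k and |c| ≤ ⌊q/(2r)⌋. Then for every i ∈ {0, …, n−1}: | (e ⊙ s')_i − (e' ⊙ s)_i + c'' + c | ≤ 2·n·k² + k + ⌊q/(2r)⌋. -/
theorem abs_cyclicShiftProduct_le {n : ℕ} {a b : ℤ} {e s : ℕ → ℤ}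
    (he : ∀ j < n, |e j| ≤ a) (hs : ∀ j < n, |s j| ≤ b) (i : ℕ) :
    |cyclicShiftProduct n e s i| ≤ n * (a * b) := by
  have key : ∀ j ∈ Finset.range n, |(if (j : ℤ) ≤ (i : ℤ) then (1 : ℤ) else -1) * e j *
      s (((i : ℤ) - (j : ℤ)) % (n : ℤ)).toNat| ≤ a * b := by
    intro j hj
    have hjn := Finset.mem_range.mp hj
    have hlt : (((i : ℤ) - (j : ℤ)) % (n : ℤ)).toNat < n := by
      have := Int.emod_lt_of_pos ((i : ℤ) - j) (b := n) (by omega)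
      omega
    have hsign : |if (j : ℤ) ≤ (i : ℤ) then (1 : ℤ) else -1| = 1 := by
      split_ifs <;> simp
    rw [abs_mul, abs_mul, hsign, one_mul]
    exact mul_le_mul (he j hjn) (hs _ hlt) (abs_nonneg _) ((abs_nonneg _).trans (he j hjn))
  calc |cyclicShiftProduct n e s i| ≤ _ := Finset.abs_sum_le_sum_abs _ _
    _ ≤ _ := Finset.sum_le_card_nsmul _ _ _ key
    _ = n * (a * b) := by simp

/-- Magnitude bound on the total noise coefficient of NewHope:
`|(e ⊙ s') i - (e' ⊙ s) i + c'' + c| ≤ 2 n k² + k + ⌊q / (2r)⌋` whenever all entries of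
`e, s', e', s` have absolute value at most `k`, `|c''| ≤ k`, and `|c| ≤ ⌊q / (2r)⌋`. -/
theorem total_noise_coeff_bound
    (n k q r : ℕ) (hn : 0 < n) (hk : 0 < k) (hq : 0 < q) (hr : 0 < r)
    (e s' e' s : ℕ → ℤ)
    (he : ∀ j < n, |e j| ≤ (k : ℤ)) (hs' : ∀ j < n, |s' j| ≤ (k : ℤ))
    (he' : ∀ j < n, |e' j| ≤ (k : ℤ)) (hs : ∀ j < n, |s j| ≤ (k : ℤ))
    (c'' c : ℤ) (hc'' : |c''| ≤ (k : ℤ)) (hc : |c| ≤ ((q / (2 * r) : ℕ) : ℤ))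
    (i : ℕ) (hi : i < n) :
    |cyclicShiftProduct n e s' i - cyclicShiftProduct n e' s i + c'' + c|
      ≤ 2 * n * (k : ℤ) ^ 2 + k + ((q / (2 * r) : ℕ) : ℤ) := by
  have h₁ := abs_le.mp (abs_cyclicShiftProduct_le he hs' i)
  have h₂ := abs_le.mp (abs_cyclicShiftProduct_le he' hs i)
  have h₃ := abs_le.mp hc''
  have h₄ := abs_le.mp hc
  rw [abs_le]
  constructor <;> linarith [h₁.1, h₁.2, h₂.1, h₂.2, h₃.1, h₃.2, h₄.1, h₄.2]
end

section
/- Let q and r be positive integers with r ≤ q, and let x be an integer with 0 ≤ x ≤ q − 1. Define h to be the representative in {0, …, r−1} of ⌊x·r/q⌉ modulo r, and define y = ⌊h·q/r⌉, where ⌊·⌉ denotes rounding to the nearest integer (with ties rounded up). Then there exists an integer κ such that | y + κ·q − x | ≤ ⌈q/(2r)⌉. -/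
/-- Rounding to the nearest integer preserves an integral bound on the distance to an integer. -/
lemma abs_round_sub_le_of_abs_sub_le {t : ℚ} {x c : ℤ} (h : |t - x| ≤ c) :
    |round t - x| ≤ c := by
  obtain ⟨h1, h2⟩ := abs_le.mp h
  rw [round_eq, abs_le]
  constructor
  · have : x - c ≤ ⌊t + 1 / 2⌋ := Int.le_floor.mpr (by push_cast; linarith)
    linarith
  · have : ⌊t + 1 / 2⌋ < x + c + 1 := Int.floor_lt.mpr (by push_cast; linarith)
    linarith

/-- Bound on the compression noise of NewHope: for `0 ≤ x ≤ q - 1`, compressing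
`x` to `h = ⌊x·r/q⌉ mod r` and decompressing to `y = ⌊h·q/r⌉` (rounding to the nearest
integer, ties up), the decompressed value differs from `x` modulo `q` by at most
`⌈q / (2r)⌉`. -/
theorem compression_noise_bound (q r : ℕ) (hq : 0 < q) (hr : 0 < r) (hrq : r ≤ q)
    (x : ℤ) (hx0 : 0 ≤ x) (hx1 : x ≤ (q : ℤ) - 1) :
    ∃ κ : ℤ,
      |round (((round ((x * r : ℚ) / q) % (r : ℤ) : ℤ) * q : ℚ) / r) + κ * q - x|
        ≤ ⌈(q : ℚ) / (2 * r)⌉ := by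
  have hq' : (0 : ℚ) < q := by exact_mod_cast hq
  have hr' : (0 : ℚ) < r := by exact_mod_cast hr
  set m : ℤ := round ((x * r : ℚ) / q)
  have hround : |(x * r : ℚ) / q - m| ≤ 1 / 2 := abs_sub_round _
  have hmod : ((m % (r : ℤ) : ℤ) : ℚ) = m - r * (m / (r : ℤ) : ℤ) := by
    rw [Int.emod_def]
    push_cast
    ring
  have hshift : ((m % (r : ℤ) : ℤ) * q : ℚ) / r
      = (m * q : ℚ) / r - ((m / (r : ℤ) * q : ℤ) : ℚ) := by
    rw [hmod]
    push_cast
    field_simp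
  refine ⟨m / (r : ℤ), ?_⟩
  rw [hshift, round_sub_intCast, sub_add_cancel]
  apply abs_round_sub_le_of_abs_sub_le
  have hscale : (m * q : ℚ) / r - x = -((q / r) * ((x * r : ℚ) / q - m)) := by
    field_simp
    ring
  calc |(m * q : ℚ) / r - x| = q / r * |(x * r : ℚ) / q - m| := by
        rw [hscale, abs_neg, abs_mul, abs_of_pos (div_pos hq' hr')]
    _ ≤ q / r * (1 / 2) := by gcongr
    _ = q / (2 * r) := by field_simp
    _ ≤ (⌈(q : ℚ) / (2 * r)⌉ : ℤ) := Int.le_ceil _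
end
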